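/- arXiv:math/0408202 — 3 statements merged into one kernel-verified Lean document; each statement's English description precedes it below -/
import Mathlib

section
/- Let G be a finite group acting faithfully and transitively on a finite set V, and suppose the stabilizer A of some point of V is maximal by inclusion among subgroups of G whose normal core in G is trivial (a md-stabilizer). Let Q be a G-invariant partition of V with more than one block in which some block has more than one element. Then the subgroup of G consisting of all elements that map each block of Q to itself is a normal subgroup of G and is nontrivial. -/
open Pointwise

/-- Let a finite group `G` act faithfully and transitively on a finite set `V`, such
that the stabilizer of some point is a md-stabilizer: maximal by inclusion among
core-free subgroups of `G`.  If `Q` is a `G`-invariant partition of `V` with more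
than one block and with some block of more than one element, then the set of
elements of `G` mapping each block of `Q` to itself is a nontrivial normal
subgroup of `G`. -/
theorem md_imprimitive_blockwise_stabilizer_normal_nontrivial
    (G : Type*) [Group G] [Finite G] (V : Type*) [Finite V]
    [MulAction G V] [FaithfulSMul G V] [MulAction.IsPretransitive G V]
    (v₀ : V)
    (hmd : ∀ B : Subgroup G, B.normalCore = ⊥ →
      MulAction.stabilizer G v₀ ≤ B → B = MulAction.stabilizer G v₀)
    (Q : Set (Set V)) (hQ : Setoid.IsPartition Q)
    (hQinv : ∀ g : G, ∀ B ∈ Q, g • B ∈ Q)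
    (hQblocks : 1 < Q.ncard) (hQbig : ∃ B ∈ Q, 1 < B.ncard) :
    ∃ K : Subgroup G, (∀ g : G, g ∈ K ↔ ∀ B ∈ Q, g • B = B) ∧ K.Normal ∧ K ≠ ⊥ := by
  have key : ∀ B ∈ Q, ∀ C ∈ Q, ∀ x, x ∈ B → x ∈ C → B = C := fun B hB C hC x hx hx' =>
    (hQ.2 x).unique ⟨hB, hx⟩ ⟨hC, hx'⟩
  obtain ⟨C, ⟨hC, hvC⟩, -⟩ := hQ.2 v₀
  have move : ∀ g : G, ∀ B ∈ Q, ∀ D ∈ Q, ∀ x, x ∈ B → g • x ∈ D → g • B = D :=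
    fun g B hB D hD x hx hgx =>
      key _ (hQinv g B hB) D hD (g • x) (Set.smul_mem_smul_set hx) hgx
  let K : Subgroup G :=
    { carrier := {g | ∀ B ∈ Q, g • B = B}
      one_mem' := fun B _ => one_smul G B
      mul_mem' := fun {a b} ha hb B hB => by
        rw [mul_smul, hb B hB, ha B hB]
      inv_mem' := fun {a} ha B hB => by
        rw [inv_smul_eq_iff, ha B hB] }
  have hK : ∀ g : G, g ∈ K ↔ ∀ B ∈ Q, g • B = B := fun g => Iff.rfl
  refine ⟨K, hK, ⟨fun n hn g => ?_⟩, fun hbot => ?_⟩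
  · rw [hK] at hn ⊢
    intro B hB
    rw [mul_smul, mul_smul, hn _ (hQinv _ B hB), smul_inv_smul]
  · have hle : (MulAction.stabilizer G C).normalCore ≤ K := by
      intro g hg
      rw [hK]
      intro B hB
      obtain ⟨b, hb⟩ : B.Nonempty := by
        rw [Set.nonempty_iff_ne_empty]
        rintro rfl
        exact hQ.1 hB
      obtain ⟨h, hh⟩ := MulAction.exists_smul_eq G v₀ b
      have hCB : h • C = B := move h C hC B hB v₀ hvC (hh ▸ hb)
      have h1 : h⁻¹ * g * h⁻¹⁻¹ ∈ MulAction.stabilizer G C := hg h⁻¹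
      rw [MulAction.mem_stabilizer_iff, inv_inv, mul_smul, mul_smul, hCB, inv_smul_eq_iff,
        hCB] at h1
      exact h1
    have hS := hmd (MulAction.stabilizer G C) (le_bot_iff.mp (hbot ▸ hle)) (by
      intro g hg
      rw [MulAction.mem_stabilizer_iff] at hg ⊢
      exact move g C hC C hC v₀ hvC (hg.symm ▸ hvC))
    obtain ⟨B, hB, hcard⟩ := hQbig
    obtain ⟨x, hx, y, hy, hxy⟩ := (Set.one_lt_ncard (Set.toFinite B)).mp hcard
    obtain ⟨h, hh⟩ := MulAction.exists_smul_eq G x v₀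
    have hBC : h • B = C := move h B hB C hC x hx (hh.symm ▸ hvC)
    have hyC : h • y ∈ C := hBC ▸ Set.smul_mem_smul_set hy
    obtain ⟨g, hg⟩ := MulAction.exists_smul_eq G v₀ (h • y)
    have hgS : g ∈ MulAction.stabilizer G C :=
      move g C hC C hC v₀ hvC (hg.symm ▸ hyC)
    rw [hS, MulAction.mem_stabilizer_iff, hg, ← hh] at hgS
    exact hxy (MulAction.injective h hgS).symm
end

section
/- Let G be a finite group acting transitively on a finite set V of cardinality n such that every non-identity element of G fixes at most one element of V. Then the number of elements of G that fix no element of V is exactly n − 1. -/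
/-- If a finite group `G` acts transitively on a finite set `V` of cardinality `n`
in such a way that every non-identity element fixes at most one point, then exactly
`n - 1` elements of `G` fix no point of `V`. -/
theorem card_fixed_point_free_elements
    (G : Type*) [Group G] [Finite G] (V : Type*) [Finite V] [Nonempty V]
    [MulAction G V] [MulAction.IsPretransitive G V] (n : ℕ) (hn : Nat.card V = n)
    (hfix : ∀ g : G, g ≠ 1 → ∀ u v : V, g • u = u → g • v = v → u = v) :
    Nat.card {g : G | ∀ v : V, g • v ≠ v} = n - 1 := by
  classical
  haveI := Fintype.ofFinite G
  haveI := Fintype.ofFinite V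
  haveI : Fintype (Quotient (MulAction.orbitRel G V)) := Fintype.ofFinite _
  have hB := MulAction.sum_card_fixedBy_eq_card_orbits_mul_card_group G V
  have hO : Fintype.card (Quotient (MulAction.orbitRel G V)) = 1 := by
    rw [Fintype.card_eq_one_iff]
    obtain ⟨v⟩ := ‹Nonempty V›
    refine ⟨Quotient.mk _ v, fun q => ?_⟩
    induction q using Quotient.inductionOn with
    | h w =>
      apply Quotient.sound
      exact MulAction.exists_smul_eq G v w
  have hpos : 0 < Fintype.card V := Fintype.card_pos
  have key : ∀ g : G, Fintype.card (MulAction.fixedBy V g)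
      + (if ∀ v : V, g • v ≠ v then 1 else 0)
      = 1 + (if g = 1 then Fintype.card V - 1 else 0) := by
    intro g
    by_cases hg : g = 1
    · subst hg
      have h1 : Fintype.card (MulAction.fixedBy V (1 : G)) = Fintype.card V := by
        apply Fintype.card_congr
        exact Equiv.subtypeUnivEquiv (fun v => one_smul G v)
      have h2 : ¬ ∀ v : V, (1 : G) • v ≠ v := by
        obtain ⟨v⟩ := ‹Nonempty V›
        exact fun h => h v (one_smul G v)
      rw [h1, if_neg h2, if_pos rfl]
      omega
    · rw [if_neg hg]
      by_cases hd : ∀ v : V, g • v ≠ v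
      · rw [if_pos hd]
        have : Fintype.card (MulAction.fixedBy V g) = 0 :=
          Fintype.card_eq_zero_iff.2 ⟨fun x => hd x.1 x.2⟩
        omega
      · rw [if_neg hd]
        push Not at hd
        obtain ⟨v, hv⟩ := hd
        have : Fintype.card (MulAction.fixedBy V g) = 1 :=
          Fintype.card_eq_one_iff.2
            ⟨⟨v, hv⟩, fun x => Subtype.ext (hfix g hg _ _ x.2 hv)⟩
        omega
  have hS := Finset.sum_congr (rfl : (Finset.univ : Finset G) = Finset.univ) (fun g _ => key g)
  rw [Finset.sum_add_distrib, Finset.sum_add_distrib, hB, hO, Finset.sum_ite_eq' Finset.univ,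
    ← Finset.card_filter] at hS
  simp only [Finset.sum_const, Finset.card_univ, Finset.mem_univ, if_true, smul_eq_mul,
    mul_one, one_mul] at hS
  rw [← hn, Nat.card_eq_fintype_card, Nat.card_eq_fintype_card]
  have hc : Fintype.card {g : G | ∀ v : V, g • v ≠ v}
      = (Finset.univ.filter (fun g : G => ∀ v : V, g • v ≠ v)).card :=
    Fintype.card_subtype _
  omega
end

section
/- Let g be a permutation of a finite set V such that g fixes no element of V and every power of g other than the identity fixes at most one element of V. Then all cycles of g have the same length (g is a regular permutation). -/
/-- A fixed-point-free permutation of a finite set all of whose non-identity powers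
fix at most one point is regular: all of its cycles have the same length. -/
theorem fixed_point_free_perm_is_regular
    (V : Type*) [Fintype V] [DecidableEq V] (g : Equiv.Perm V)
    (hfpf : ∀ v : V, g v ≠ v)
    (hpow : ∀ k : ℕ, g ^ k ≠ 1 → ∀ u v : V, (g ^ k) u = u → (g ^ k) v = v → u = v) :
    ∀ c ∈ g.cycleType, ∀ c' ∈ g.cycleType, c = c' := by
  have key : ∀ c ∈ g.cycleType, c = orderOf g := by
    intro c hc
    apply Nat.dvd_antisymm (Equiv.Perm.dvd_of_mem_cycleType hc)
    apply orderOf_dvd_of_pow_eq_one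
    rw [Equiv.Perm.cycleType_def, Multiset.mem_map] at hc
    obtain ⟨σ, hσ, rfl⟩ := hc
    have hσ' : σ ∈ g.cycleFactorsFinset := hσ
    have hcyc := (Equiv.Perm.mem_cycleFactorsFinset_iff.mp hσ').1
    obtain ⟨x, hx⟩ := hcyc.nonempty_support
    have he := Equiv.Perm.cycle_is_cycleOf hx hσ'
    have h1 : (g ^ σ.support.card) x = x := by
      rw [← Equiv.Perm.cycleOf_pow_apply_self, ← he, ← hcyc.orderOf, pow_orderOf_eq_one]
      rfl
    by_contra hne
    refine hfpf x (hpow _ hne _ _ ?_ h1)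
    change (g ^ σ.support.card) (g x) = g x
    rw [← Equiv.Perm.mul_apply, ← pow_succ, pow_succ', Equiv.Perm.mul_apply, h1]
  intro c hc c' hc'
  rw [key c hc, key c' hc']
end
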